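/- Fix a real ε ∈ (0, 1/2]. Let F = GF(q) be a finite field, let C be a linear [n,k] code over F of rate k/n ∈ [ε, 1-ε], let L be a positive integer with L < (1/√(2n)) · 2^{η_q(ε)·n}, and let τ be a nonnegative integer with τ ≥ L(n-k)/(L+1). If C is (τ,L)-list decodable, then C is MDS. -/

import Mathlib

/-- The minimum Hamming distance of a linear code `C`, i.e. the minimum
Hamming weight of a nonzero codeword of `C`. -/
noncomputable def minHammingDist {F : Type*} [Field F] [DecidableEq F]
    {ι : Type*} [Fintype ι] (C : Submodule F (ι → F)) : ℕ :=
  sInf {w : ℕ | ∃ c ∈ C, c ≠ 0 ∧ hammingNorm c = w}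

/-- A linear code of dimension `k` in `F^ι` is MDS if its minimum Hamming
distance equals `n - k + 1`, where `n = |ι|`. -/
noncomputable def IsMDSCode {F : Type*} [Field F] [DecidableEq F]
    {ι : Type*} [Fintype ι] (k : ℕ) (C : Submodule F (ι → F)) : Prop :=
  minHammingDist C = Fintype.card ι - k + 1

/-- A code `C ⊆ F^ι` is `(τ, L)`-list decodable if every Hamming ball of
radius `τ` contains at most `L` codewords. -/
def ListDecodable {F : Type*} [Field F] [DecidableEq F]
    {ι : Type*} [Fintype ι] (C : Set (ι → F)) (τ L : ℕ) : Prop :=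
  ∀ y : ι → F, ({c | c ∈ C ∧ hammingDist y c ≤ τ}).ncard ≤ L

/-- The binary entropy function `h(x) = -x log₂ x - (1-x) log₂ (1-x)`
(with `h(0) = h(1) = 0`). -/
noncomputable def binEnt (x : ℝ) : ℝ :=
  -x * Real.logb 2 x - (1 - x) * Real.logb 2 (1 - x)

/-- The function `η_q(ε) = h((q-1)/q · (1-ε)) - (1-ε) · h(1/q)`. -/
noncomputable def etaQ (q : ℕ) (ε : ℝ) : ℝ :=
  binEnt (((q : ℝ) - 1) / (q : ℝ) * (1 - ε)) - (1 - ε) * binEnt (1 / (q : ℝ))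

theorem Stirling.stirlingSeq_le_of_le {m n : ℕ} (hm : 1 ≤ m) (h : m ≤ n) :
    Stirling.stirlingSeq n ≤ Stirling.stirlingSeq m := by
  obtain ⟨a, rfl⟩ := Nat.exists_eq_add_of_le' hm
  obtain ⟨b, rfl⟩ := Nat.exists_eq_add_of_le' (hm.trans h)
  exact Stirling.stirlingSeq'_antitone (by omega : a ≤ b)

theorem Stirling.stirlingSeq_pos {n : ℕ} (hn : 1 ≤ n) : 0 < Stirling.stirlingSeq n := by
  obtain ⟨a, rfl⟩ := Nat.exists_eq_add_of_le' hn
  exact Stirling.stirlingSeq'_pos a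

theorem Stirling.stirlingSeq_two : Stirling.stirlingSeq 2 = Real.exp 1 ^ 2 / 4 := by
  have h : √(2 * ((2 : ℕ) : ℝ)) = 2 := by
    rw [Real.sqrt_eq_iff_mul_self_eq] <;> norm_num
  rw [Stirling.stirlingSeq, h, Nat.factorial_two]
  push_cast
  field_simp
  norm_num

theorem Stirling.stirlingSeq_one_sq : Stirling.stirlingSeq 1 ^ 2 = Real.exp 1 ^ 2 / 2 := by
  rw [Stirling.stirlingSeq_one, div_pow, Real.sq_sqrt (by norm_num)]

theorem Real.exp_one_pow_four_lt : Real.exp 1 ^ 4 < 54.7 := by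
  have h := Real.exp_one_lt_d9
  calc Real.exp 1 ^ 4 < 2.7182818286 ^ 4 := by gcongr
    _ < 54.7 := by norm_num

theorem Stirling.stirlingSeq_mul_le_of_two_le {m j : ℕ} (hm : 2 ≤ m) (hj : 2 ≤ j) :
    Stirling.stirlingSeq m * Stirling.stirlingSeq j * √(m * j) ≤
      Stirling.stirlingSeq (m + j) * (m + j) := by
  have hsqrt : √((m : ℝ) * j) ≤ (m + j) / 2 := by
    rw [Real.sqrt_le_left (by positivity)]
    nlinarith [sq_nonneg ((m : ℝ) - j)]
  have hprod : Stirling.stirlingSeq m * Stirling.stirlingSeq j ≤ 2 * √Real.pi := by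
    calc Stirling.stirlingSeq m * Stirling.stirlingSeq j
        ≤ Stirling.stirlingSeq 2 * Stirling.stirlingSeq 2 :=
          mul_le_mul (stirlingSeq_le_of_le (by norm_num) hm)
            (stirlingSeq_le_of_le (by norm_num) hj) (stirlingSeq_pos (by omega)).le
            (stirlingSeq_pos (by omega)).le
      _ = Real.exp 1 ^ 4 / 16 := by rw [stirlingSeq_two]; ring
      _ ≤ 2 * √Real.pi := by
          have : (1.75 : ℝ) ≤ √Real.pi := Real.le_sqrt_of_sq_le (by linarith [Real.pi_gt_d2])
          linarith [Real.exp_one_pow_four_lt]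
  calc Stirling.stirlingSeq m * Stirling.stirlingSeq j * √(m * j)
      ≤ (2 * √Real.pi) * ((m + j) / 2) := by gcongr
    _ = √Real.pi * (m + j) := by ring
    _ ≤ _ := by gcongr; exact sqrt_pi_le_stirlingSeq (by omega)

theorem Stirling.stirlingSeq_one_mul_le {j : ℕ} (hj : 1 ≤ j) :
    Stirling.stirlingSeq 1 * Stirling.stirlingSeq j * √j ≤
      Stirling.stirlingSeq (1 + j) * (1 + j) := by
  rcases hj.eq_or_lt with rfl | hj2
  · have := stirlingSeq_one_sq
    rw [show 1 + 1 = 2 from rfl, stirlingSeq_two, ← sq, this]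
    norm_num
    linarith
  · have hj' : (2 : ℝ) ≤ j := by exact_mod_cast hj2
    calc Stirling.stirlingSeq 1 * Stirling.stirlingSeq j * √j
        ≤ Stirling.stirlingSeq 1 * Stirling.stirlingSeq 1 * √j := by
          gcongr
          · exact (stirlingSeq_pos le_rfl).le
          · exact stirlingSeq_le_of_le le_rfl hj
      _ = Real.exp 1 ^ 2 / 2 * √j := by rw [← sq, stirlingSeq_one_sq]
      _ ≤ √Real.pi * (1 + j) := by
          apply le_of_sq_le_sq _ (by positivity)
          rw [mul_pow, mul_pow, Real.sq_sqrt (by positivity), Real.sq_sqrt (by positivity)]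
          have h1 := Real.exp_one_pow_four_lt
          have h2 := Real.pi_gt_d2
          have h3 : (9 / 2 : ℝ) * j ≤ (1 + j) ^ 2 := by nlinarith
          calc (Real.exp 1 ^ 2 / 2) ^ 2 * (j : ℝ) = Real.exp 1 ^ 4 / 4 * j := by ring
            _ ≤ (3.14 * (9 / 2)) * (j : ℝ) := by gcongr; linarith
            _ = 3.14 * ((9 / 2) * (j : ℝ)) := by ring
            _ ≤ Real.pi * (1 + j) ^ 2 := by gcongr
      _ ≤ _ := by gcongr; exact sqrt_pi_le_stirlingSeq (by omega)

theorem Stirling.stirlingSeq_mul_le {m j : ℕ} (hm : 1 ≤ m) (hj : 1 ≤ j) :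
    Stirling.stirlingSeq m * Stirling.stirlingSeq j * √(m * j) ≤
      Stirling.stirlingSeq (m + j) * (m + j) := by
  rcases hm.eq_or_lt with rfl | hm2
  · simpa using stirlingSeq_one_mul_le hj
  rcases hj.eq_or_lt with rfl | hj2
  · have := stirlingSeq_one_mul_le hm
    rw [mul_comm (stirlingSeq m), add_comm m, add_comm (m : ℝ)]
    simpa using this
  · exact stirlingSeq_mul_le_of_two_le hm2 hj2

theorem Stirling.factorial_eq_stirlingSeq_mul {n : ℕ} (hn : 1 ≤ n) :
    (n.factorial : ℝ) = stirlingSeq n * (√(2 * n) * (n / Real.exp 1) ^ n) := by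
  rw [stirlingSeq, div_mul_cancel₀]
  positivity

/-- Lower bound on a binomial coefficient, sharp for `m = j = 1`. -/
theorem Nat.pow_self_le_sqrt_mul_choose {m j : ℕ} (hm : 1 ≤ m) (hj : 1 ≤ j) :
    ((m : ℝ) + j) ^ (m + j) ≤ √(2 * (m + j)) * (m + j).choose m * (m ^ m * j ^ j) := by
  have hfac : ((m + j).choose m : ℝ) * m.factorial * j.factorial = (m + j).factorial := by
    exact_mod_cast Nat.add_sub_cancel_left (n := m) (m := j) ▸
      Nat.choose_mul_factorial_mul_factorial (Nat.le_add_right m j)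
  rw [Stirling.factorial_eq_stirlingSeq_mul hm, Stirling.factorial_eq_stirlingSeq_mul hj,
    Stirling.factorial_eq_stirlingSeq_mul (by omega : 1 ≤ m + j)] at hfac
  push_cast at hfac
  have hs := Stirling.stirlingSeq_mul_le hm hj
  have hpos := Stirling.stirlingSeq_pos (by omega : 1 ≤ m + j)
  have h2 : √(2 * (m : ℝ)) * √(2 * j) = 2 * √(m * j) := by
    rw [← Real.sqrt_mul (by positivity), show (2 * (m : ℝ)) * (2 * j) = 2 ^ 2 * (m * j) by ring,
      Real.sqrt_mul (by positivity), Real.sqrt_sq (by norm_num)]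
  have h3 : √(2 * ((m : ℝ) + j)) * √(2 * (m + j)) = 2 * (m + j) :=
    Real.mul_self_sqrt (by positivity)
  have hsqrt : 0 < √(2 * ((m : ℝ) + j)) := by positivity
  set r := √(2 * ((m : ℝ) + j))
  set c : ℝ := ((m + j).choose m : ℝ)
  have key : c * (m ^ m * j ^ j) * 2 *
      (Stirling.stirlingSeq m * Stirling.stirlingSeq j * √(m * j)) =
      Stirling.stirlingSeq (m + j) * r * ((m : ℝ) + j) ^ (m + j) := by
    simp only [div_pow] at hfac
    rw [pow_add (Real.exp 1)] at hfac
    have he := Real.exp_pos 1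
    field_simp at hfac
    linear_combination hfac - c * (m ^ m * j ^ j) *
      (Stirling.stirlingSeq m * Stirling.stirlingSeq j) * h2
  have h4 : (Stirling.stirlingSeq (m + j) * r) * ((m : ℝ) + j) ^ (m + j) ≤
      (Stirling.stirlingSeq (m + j) * r) * (r * c * (m ^ m * j ^ j)) := by
    rw [← key]
    calc _ ≤ c * (m ^ m * j ^ j) * 2 * (Stirling.stirlingSeq (m + j) * (m + j)) := by gcongr
      _ = _ := by linear_combination - Stirling.stirlingSeq (m + j) * c * (m ^ m * j ^ j) * h3
  exact le_of_mul_le_mul_left h4 (by positivity)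

theorem Real.mul_binEntropy_div_le_log_choose {m j : ℕ} (hm : 1 ≤ m) (hj : 1 ≤ j) :
    ((m : ℝ) + j) * Real.binEntropy (m / (m + j)) ≤
      Real.log (√(2 * (m + j)) * (m + j).choose m) := by
  have hm0 : (0 : ℝ) < m := by positivity
  have hj0 : (0 : ℝ) < j := by positivity
  have hc : (0 : ℝ) < (m + j).choose m := by
    exact_mod_cast Nat.choose_pos (by omega)
  have h := Real.log_le_log (by positivity) (Nat.pow_self_le_sqrt_mul_choose hm hj)
  rw [Real.log_mul (by positivity) (by positivity),
    Real.log_mul (by positivity) (by positivity)] at h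
  rw [Real.log_mul (x := (m : ℝ) ^ m) (by positivity) (by positivity)] at h
  simp only [Real.log_pow] at h
  have hsub : 1 - (m : ℝ) / (m + j) = j / (m + j) := by field_simp; ring
  rw [Real.binEntropy, hsub, inv_div, inv_div, Real.log_div (by positivity) (by positivity),
    Real.log_div (by positivity) (by positivity)]
  push_cast at h
  rw [Real.log_mul (by positivity) (by positivity)]
  have : ((m : ℝ) + j) * (m / (m + j) * (Real.log (m + j) - Real.log m) +
      j / (m + j) * (Real.log (m + j) - Real.log j)) =
      (m + j) * Real.log (m + j) - (m * Real.log m + j * Real.log j) := by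
    field_simp
    ring
  linarith

section
variable {F : Type*} [Field F] [DecidableEq F] {ι : Type*} [Fintype ι]

theorem card_hammingNorm_eq [Fintype F] [DecidableEq ι] (m : ℕ) :
    (Finset.univ.filter fun x : ι → F => hammingNorm x = m).card =
      (Fintype.card ι).choose m * (Fintype.card F - 1) ^ m := by
  have hmaps : Set.MapsTo (fun x : ι → F => Finset.univ.filter fun i => x i ≠ 0)
      (Finset.univ.filter fun x : ι → F => hammingNorm x = m)
      ((Finset.univ : Finset ι).powersetCard m) := by
    intro x hx
    simpa [hammingNorm, Finset.mem_powersetCard] using hx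
  rw [Finset.card_eq_sum_card_fiberwise hmaps, Finset.sum_const_nat
    (m := (Fintype.card F - 1) ^ m), Finset.card_powersetCard, Finset.card_univ]
  intro S hS
  rw [Finset.mem_powersetCard] at hS
  have : (Finset.filter (fun x : ι → F => Finset.univ.filter (fun i => x i ≠ 0) = S)
      (Finset.univ.filter fun x : ι → F => hammingNorm x = m)) =
      Fintype.piFinset fun i => if i ∈ S then Finset.univ.erase (0 : F) else {0} := by
    ext x
    simp only [Finset.mem_filter, Finset.mem_univ, true_and, Fintype.mem_piFinset]
    constructor
    · rintro ⟨-, rfl⟩ i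
      by_cases h : x i = 0 <;> simp [h]
    · intro h
      have hx : Finset.univ.filter (fun i => x i ≠ 0) = S := by
        ext i
        have := h i
        by_cases hi : i ∈ S <;> simp_all
      exact ⟨by rw [hammingNorm, hx, hS.2], hx⟩
  rw [this, Fintype.card_piFinset]
  have hcard (i : ι) : (if i ∈ S then Finset.univ.erase (0 : F) else {0}).card =
      if i ∈ S then Fintype.card F - 1 else 1 := by
    split_ifs <;> simp
  simp_rw [hcard]
  rw [Finset.prod_ite_mem, Finset.univ_inter, Finset.prod_const, hS.2]

/-- Averaging over the centre of a Hamming ball. -/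
theorem ListDecodable.card_mul_le [Fintype F] [DecidableEq ι] {C : Submodule F (ι → F)} {τ L m : ℕ}
    (h : ListDecodable (C : Set (ι → F)) τ L) (hm : m ≤ τ) :
    Fintype.card F ^ Module.finrank F C *
        ((Fintype.card ι).choose m * (Fintype.card F - 1) ^ m) ≤
      L * Fintype.card F ^ Fintype.card ι := by
  classical
  let B := (Finset.univ.filter fun x : ι → F => hammingNorm x = m)
  have hinj : ((Finset.univ : Finset C) ×ˢ B).card ≤
      L * (Finset.univ : Finset (ι → F)).card := by
    apply Finset.card_le_mul_card_image_of_maps_to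
      (f := fun p : C × (ι → F) => (p.1 : ι → F) + p.2) (fun _ _ => Finset.mem_univ _)
    intro y _
    refine le_trans ?_ (h y)
    rw [← Set.ncard_coe_finset]
    refine Set.ncard_le_ncard_of_injOn (fun p => (p.1 : ι → F)) ?_ ?_ (Set.toFinite _)
    · rintro ⟨c, e⟩ hp
      simp only [Finset.coe_filter, Finset.mem_product, Finset.mem_univ, true_and, B,
        Finset.mem_filter, Set.mem_ofPred_eq] at hp
      obtain ⟨he, rfl⟩ := hp
      refine ⟨c.2, ?_⟩
      rw [hammingDist_comm, hammingDist_eq_hammingNorm]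
      simpa [he] using hm
    · rintro ⟨c, e⟩ hp ⟨c', e'⟩ hp' hcc
      simp only [Finset.coe_filter, Finset.mem_product, Finset.mem_univ, true_and,
        Set.mem_ofPred_eq] at hp hp' hcc
      obtain rfl := Subtype.ext hcc
      have := hp.2.trans hp'.2.symm
      simpa using this
  rw [Finset.card_product, card_hammingNorm_eq, Finset.card_univ, Finset.card_univ,
    Module.card_eq_pow_finrank (K := F) (V := C), Fintype.card_fun] at hinj
  exact hinj

theorem Finset.exists_balanced_coloring {α : Type*} [DecidableEq α] (S : Finset α) (r : ℕ) :
    ∃ f : α → Fin (r + 1), ∀ j, S.card / (r + 1) ≤ (S.filter fun i => f i = j).card := by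
  classical
  let e := S.equivFin
  refine ⟨fun i => if h : i ∈ S then Fin.ofNat (r + 1) (e ⟨i, h⟩) else 0, fun j => ?_⟩
  have hlt (s : Fin (S.card / (r + 1))) : s * (r + 1) + j < S.card := by
    have h1 := Nat.mul_le_mul_right (r + 1) (show (s : ℕ) + 1 ≤ S.card / (r + 1) from s.2)
    have h2 := Nat.div_mul_le_self S.card (r + 1)
    have h3 := j.2
    linarith [add_one_mul (s : ℕ) (r + 1)]
  rw [← Fintype.card_fin (S.card / (r + 1)), ← Finset.card_univ]
  refine Finset.card_le_card_of_injOn (fun s => (e.symm ⟨s * (r + 1) + j, hlt s⟩ : α)) ?_ ?_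
  · intro s _
    simp [Fin.ext_iff, Nat.mod_eq_of_lt j.2]
  · intro s _ t _ hst
    simpa [Fin.ext_iff] using hst

theorem exists_many_multiples_near [Fintype F] {c : ι → F} (hc : c ≠ 0) {τ L N : ℕ}
    (hL : L < Fintype.card F) (hw : hammingNorm c ≤ N) (hτ : L * N ≤ (L + 1) * τ)
    {C : Submodule F (ι → F)} (hcC : c ∈ C) :
    ¬ ListDecodable (C : Set (ι → F)) τ L := by
  classical
  intro h
  obtain ⟨f, hf⟩ := Finset.exists_balanced_coloring
    (Finset.univ.filter fun i => c i ≠ 0) L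
  obtain ⟨α⟩ : Nonempty (Fin (L + 1) ↪ F) :=
    Function.Embedding.nonempty_of_card_le (by simpa using hL)
  have hle := h fun i => α (f i) * c i
  have hinj : Function.Injective fun j => α j • c := fun i j hij =>
    α.injective (smul_left_injective F hc hij)
  have hsub : Set.range (fun j => α j • c) ⊆
      {x | x ∈ (C : Set (ι → F)) ∧ hammingDist (fun i => α (f i) * c i) x ≤ τ} := by
    rintro _ ⟨j, rfl⟩
    refine ⟨C.smul_mem _ hcC, ?_⟩
    have hsplit := Finset.card_filter_add_card_filter_not
      (s := Finset.univ.filter fun i => c i ≠ 0) (fun i => f i = j)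
    have hdist : hammingDist (fun i => α (f i) * c i) (α j • c) =
        ((Finset.univ.filter fun i => c i ≠ 0).filter fun i => ¬ f i = j).card := by
      rw [hammingDist, Finset.filter_filter]
      congr 1
      ext i
      simp [not_or, and_comm]
    have hj := hf j
    change (Finset.univ.filter fun i => c i ≠ 0).card ≤ N at hw
    rw [hdist]
    set w := (Finset.univ.filter fun i => c i ≠ 0).card
    set d := ((Finset.univ.filter fun i => c i ≠ 0).filter fun i => ¬ f i = j).card
    have hd : d ≤ w - w / (L + 1) := by omega
    have hmod := Nat.div_add_mod w (L + 1)
    have hlt := Nat.mod_lt w (by omega : 0 < L + 1)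
    by_contra! hcon
    have h1 : τ + 1 + w / (L + 1) ≤ w := by omega
    have h2 := Nat.mul_le_mul_left (L + 1) h1
    have h3 := Nat.mul_le_mul_left L hw
    nlinarith
  have hcard := Set.ncard_le_ncard hsub (Set.toFinite _)
  rw [Set.ncard_range_of_injective hinj, Nat.card_fin] at hcard
  omega

/-- Singleton bound. -/
theorem exists_mem_hammingNorm_le {C : Submodule F (ι → F)} (hk : 1 ≤ Module.finrank F C) :
    ∃ c ∈ C, c ≠ 0 ∧ hammingNorm c ≤ Fintype.card ι - Module.finrank F C + 1 := by
  classical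
  have hle : Module.finrank F C ≤ Fintype.card ι := by
    simpa using C.finrank_le
  obtain ⟨T, -, hT⟩ := Finset.exists_subset_card_eq
    (s := (Finset.univ : Finset ι)) (n := Module.finrank F C - 1) (by simp; omega)
  let f : C →ₗ[F] (T → F) := (LinearMap.funLeft F F (Subtype.val : T → ι)).comp C.subtype
  have hker : LinearMap.ker f ≠ ⊥ := LinearMap.ker_ne_bot_of_finrank_lt (by simp [hT]; omega)
  obtain ⟨c, hc, hc0⟩ := (Submodule.ne_bot_iff _).mp hker
  refine ⟨c, c.2, by simpa using hc0, ?_⟩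
  have hsub : (Finset.univ.filter fun i => (c : ι → F) i ≠ 0) ⊆ Tᶜ := by
    intro i hi
    simp only [Finset.mem_filter, Finset.mem_univ, true_and] at hi
    rw [Finset.mem_compl]
    intro hiT
    exact hi (congrFun (LinearMap.mem_ker.mp hc) ⟨i, hiT⟩)
  have := Finset.card_le_card hsub
  rw [Finset.card_compl, hT] at this
  change (Finset.univ.filter fun i => (c : ι → F) i ≠ 0).card ≤ _
  omega

theorem exists_mem_hammingNorm_le_of_not_isMDSCode {C : Submodule F (ι → F)}
    (hk : 1 ≤ Module.finrank F C) (h : ¬ IsMDSCode (Module.finrank F C) C) :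
    ∃ c ∈ C, c ≠ 0 ∧ hammingNorm c ≤ Fintype.card ι - Module.finrank F C := by
  obtain ⟨c, hcC, hc0, hc⟩ := exists_mem_hammingNorm_le hk
  have hmem := Nat.sInf_mem (s := {w : ℕ | ∃ c ∈ C, c ≠ 0 ∧ hammingNorm c = w})
    ⟨_, c, hcC, hc0, rfl⟩
  have hle := Nat.sInf_le (s := {w : ℕ | ∃ c ∈ C, c ≠ 0 ∧ hammingNorm c = w})
    ⟨c, hcC, hc0, rfl⟩
  obtain ⟨c', hc'C, hc'0, hc'⟩ := hmem
  refine ⟨c', hc'C, hc'0, ?_⟩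
  rw [IsMDSCode, minHammingDist] at h
  omega
end

theorem binEnt_eq (x : ℝ) : binEnt x = Real.binEntropy x / Real.log 2 := by
  simp only [binEnt, Real.binEntropy, Real.logb, Real.log_inv]
  ring

theorem concaveOn_binEntropy_mul_sub {a : ℝ} (ha0 : 0 < a) (ha1 : a < 1) :
    ConcaveOn ℝ (Set.Icc 0 (1 / 2))
      fun x => Real.binEntropy (a * x) - Real.binEntropy (a * (1 - x)) := by
  have hderiv {x : ℝ} (hx : x ∈ Set.Ioo (0 : ℝ) (1 / 2)) :
      HasDerivAt (fun x => Real.binEntropy (a * x) - Real.binEntropy (a * (1 - x)))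
        (a * Real.log (1 + (1 - a) / (a ^ 2 * (x * (1 - x))))) x := by
    obtain ⟨hx0, hx1⟩ := hx
    have hx2 : 0 < 1 - x := by linarith
    have h1 : 0 < 1 - a * x := by nlinarith
    have h2 : 0 < 1 - a * (1 - x) := by nlinarith
    have d1 := (Real.hasDerivAt_binEntropy (p := a * x) (by positivity) (by linarith)).comp x
      ((hasDerivAt_id x).const_mul a)
    have d2 := (Real.hasDerivAt_binEntropy (p := a * (1 - x)) (by positivity) (by linarith)).comp x
      (((hasDerivAt_id x).const_sub 1).const_mul a)
    refine (d1.sub d2).congr_deriv ?_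
    have h3 : 1 + (1 - a) / (a ^ 2 * (x * (1 - x))) =
        ((1 - a * x) * (1 - a * (1 - x))) / ((a * x) * (a * (1 - x))) := by
      field_simp
      ring
    rw [h3, Real.log_div (by positivity) (by positivity), Real.log_mul h1.ne' h2.ne',
      Real.log_mul (x := a * x) (by positivity) (by positivity)]
    ring
  apply AntitoneOn.concaveOn_of_deriv (convex_Icc _ _)
  · fun_prop
  · rw [interior_Icc]
    exact fun x hx => (hderiv hx).differentiableAt.differentiableWithinAt
  · rw [interior_Icc]
    intro x hx y hy hxy
    rw [(hderiv hx).deriv, (hderiv hy).deriv]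
    obtain ⟨hx0, hx1⟩ := hx
    obtain ⟨hy0, hy1⟩ := hy
    have h1 : 0 < x * (1 - x) := mul_pos hx0 (by linarith)
    have h2 : x * (1 - x) ≤ y * (1 - y) := by nlinarith
    have h3 : 0 < 1 - a := by linarith
    have h4 : 0 < y * (1 - y) := h1.trans_le h2
    gcongr

/-- On the symmetric interval `[ε, 1 - ε]`, the function `h(a x) - x h(a)` is smallest at `1 - ε`. -/
theorem binEntropy_mul_sub_ge {a ε x : ℝ} (ha0 : 0 < a) (ha1 : a < 1) (hε0 : 0 ≤ ε)
    (hε : ε ≤ 1 / 2) (hx : x ∈ Set.Icc ε (1 - ε)) :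
    Real.binEntropy (a * (1 - ε)) - (1 - ε) * Real.binEntropy a ≤
      Real.binEntropy (a * x) - x * Real.binEntropy a := by
  have hend : Real.binEntropy (a * (1 - ε)) - (1 - ε) * Real.binEntropy a ≤
      Real.binEntropy (a * ε) - ε * Real.binEntropy a := by
    have h := (concaveOn_binEntropy_mul_sub ha0 ha1).2
      (x := 0) (y := 1 / 2) (by simp) (by simp)
      (show 0 ≤ 1 - 2 * ε by linarith) (show 0 ≤ 2 * ε by linarith) (by ring)
    norm_num at h
    rw [show 2 * ε * (1 / 2) = ε by ring] at h
    linarith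
  have hconc : ConcaveOn ℝ (Set.Icc (0 : ℝ) 1)
      fun x => Real.binEntropy (a * x) - x * Real.binEntropy a := by
    refine ⟨convex_Icc _ _, fun x hx y hy s t hs ht hst => ?_⟩
    have h := Real.strictConcave_binEntropy.concaveOn.2
      (x := a * x) (y := a * y) ⟨by nlinarith [hx.1], by nlinarith [hx.2]⟩
      ⟨by nlinarith [hy.1], by nlinarith [hy.2]⟩ hs ht hst
    simp only [smul_eq_mul] at h ⊢
    rw [show s * (a * x) + t * (a * y) = a * (s * x + t * y) by ring] at h
    linarith
  have hmin := hconc.min_le_of_mem_Icc (x := ε) (y := 1 - ε) (z := x)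
    ⟨hε0, by linarith⟩ ⟨by linarith, by linarith⟩ hx
  rwa [min_eq_right hend] at hmin

theorem binEntropy_one_div {q : ℕ} (hq : 2 ≤ q) :
    Real.binEntropy (1 / q) = Real.log q - ((q : ℝ) - 1) / q * Real.log (q - 1) := by
  have hq' : (2 : ℝ) ≤ q := by exact_mod_cast hq
  have hq1 : (0 : ℝ) < q - 1 := by linarith
  rw [Real.binEntropy, show 1 - 1 / (q : ℝ) = (q - 1) / q by field_simp, inv_div, inv_div, div_one,
    Real.log_div (by positivity) (by positivity)]
  field_simp
  ring

/-- The first-moment exponent of a Hamming sphere of relative radius `p` at rate `1 - x`. -/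
theorem etaQ_mul_log_two_le {q : ℕ} (hq : 2 ≤ q) {ε x p : ℝ} (hε0 : 0 ≤ ε) (hε : ε ≤ 1 / 2)
    (hx : x ∈ Set.Icc ε (1 - ε)) (hp : ((q : ℝ) - 1) / q * x ≤ p) (hp1 : p ≤ ((q : ℝ) - 1) / q) :
    etaQ q ε * Real.log 2 ≤ Real.binEntropy p + p * Real.log (q - 1) - x * Real.log q := by
  have hq' : (2 : ℝ) ≤ q := by exact_mod_cast hq
  have hq1 : (0 : ℝ) < q - 1 := by linarith
  have ha0 : 0 < ((q : ℝ) - 1) / q := by positivity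
  have ha : ((q : ℝ) - 1) / q = 1 - 1 / q := by field_simp
  have ha1 : ((q : ℝ) - 1) / q < 1 := by rw [div_lt_one (by positivity)]; linarith
  have hb : Real.binEntropy (((q : ℝ) - 1) / q) = Real.binEntropy (1 / q) := by
    rw [ha, Real.binEntropy_one_sub]
  have hmin := binEntropy_mul_sub_ge ha0 ha1 hε0 hε hx
  have hx0 : 0 ≤ x := hε0.trans hx.1
  have hmono := (Real.qaryEntropy_strictMonoOn hq).monotoneOn
    (a := ((q : ℝ) - 1) / q * x) (b := p) ⟨by positivity, by rw [← ha]; exact hp.trans hp1⟩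
    ⟨le_trans (by positivity) hp, by rw [← ha]; exact hp1⟩ hp
  have heta : etaQ q ε * Real.log 2 = Real.binEntropy (((q : ℝ) - 1) / q * (1 - ε)) -
      (1 - ε) * Real.binEntropy (1 / q) := by
    have : Real.log 2 ≠ 0 := (Real.log_pos (by norm_num)).ne'
    rw [etaQ, binEnt_eq, binEnt_eq]
    field_simp
  rw [hb, ← heta, binEntropy_one_div hq] at hmin
  simp only [Real.qaryEntropy] at hmono
  push_cast at hmono
  linarith

theorem log_sqrt_mul_choose_ge {n m : ℕ} (hm : 1 ≤ m) (hmn : m < n) :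
    (n : ℝ) * Real.binEntropy (m / n) ≤ Real.log (√(2 * n) * n.choose m) := by
  obtain ⟨j, rfl⟩ := Nat.exists_eq_add_of_lt hmn
  have h := Real.mul_binEntropy_div_le_log_choose hm (Nat.le_add_left 1 j)
  push_cast at h ⊢
  simpa only [add_assoc] using h

/-- There is a radius `m ≤ τ` with `(q - 1)(n - k)/q ≤ m ≤ (q - 1)n/q`. -/
theorem exists_radius {q n k L τ : ℕ} (hq : 2 ≤ q) (hk : 1 ≤ k) (hkn : k < n) (hL : q ≤ L)
    (hτ : L * (n - k) ≤ (L + 1) * τ) :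
    ∃ m, 1 ≤ m ∧ m < n ∧ m ≤ τ ∧ (q - 1) * (n - k) ≤ q * m ∧ q * m ≤ (q - 1) * n := by
  obtain ⟨r, rfl⟩ := Nat.exists_eq_add_of_le' (by omega : 1 ≤ q)
  obtain ⟨N, rfl⟩ := Nat.exists_eq_add_of_lt hkn
  obtain ⟨l, rfl⟩ := Nat.exists_eq_add_of_le' hk
  simp only [Nat.add_sub_cancel, show l + 1 + N + 1 - (l + 1) = N + 1 by omega] at *
  have hdm := Nat.div_add_mod (r * (N + 1) + r) (r + 1)
  have hlt := Nat.mod_lt (r * (N + 1) + r) (by omega : 0 < r + 1)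
  set m := (r * (N + 1) + r) / (r + 1)
  have hlow : r * (N + 1) ≤ (r + 1) * m := by omega
  have hup : (r + 1) * m ≤ r * (l + 1 + N + 1) := by
    have : (r + 1) * m ≤ r * (N + 1) + r := by omega
    linarith [Nat.zero_le (r * l), mul_add r l (N + 1 + 1)]
  have hr : 1 ≤ r := by omega
  refine ⟨m, ?_, ?_, ?_, hlow, hup⟩
  · refine Nat.pos_of_ne_zero fun h0 => ?_
    rw [h0] at hlow
    nlinarith
  · by_contra! h0
    nlinarith
  · by_contra! h0
    have h1 : (r + 1) * (τ + 1) ≤ r * (N + 1) + r :=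
      (Nat.mul_le_mul_left _ h0).trans (by omega)
    have h2 : (r + 1) * τ + 1 ≤ r * (N + 1) := by linarith
    have h3 : τ ≤ N := by nlinarith
    have h4 : L * (N + 1 - τ) ≤ τ := by
      zify [show τ ≤ N + 1 by omega] at hτ ⊢
      linarith
    have h5 : r * (N + 1 - τ) ≤ L * (N + 1 - τ) := Nat.mul_le_mul_right _ (by omega)
    have h6 : τ + 1 ≤ r * (N + 1 - τ) := by
      zify [show τ ≤ N + 1 by omega] at h2 ⊢
      linarith
    omega

theorem not_listDecodable_of_card_le {F : Type*} [Field F] [Fintype F] [DecidableEq F]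
    {n k L τ : ℕ} {ε : ℝ} (hε0 : 0 < ε) (hε : ε ≤ 1 / 2)
    {C : Submodule F (Fin n → F)} (hk : Module.finrank F C = k) (hk1 : 1 ≤ k) (hkn : k < n)
    (hR : ((n - k : ℕ) : ℝ) / n ∈ Set.Icc ε (1 - ε)) (hL : Fintype.card F ≤ L)
    (hLub : (L : ℝ) <
      (1 / Real.sqrt (2 * n)) * (2 : ℝ) ^ (etaQ (Fintype.card F) ε * n))
    (hτ : L * (n - k) ≤ (L + 1) * τ) :
    ¬ ListDecodable (C : Set (Fin n → F)) τ L := by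
  intro hdec
  have hq : 2 ≤ Fintype.card F := Fintype.one_lt_card
  obtain ⟨m, hm1, hmn, hmτ, hlow, hup⟩ := exists_radius hq hk1 hkn hL hτ
  have havg := hdec.card_mul_le hmτ
  rw [hk, Fintype.card_fin] at havg
  set q := Fintype.card F
  have hn0 : (0 : ℝ) < n := by exact_mod_cast (by omega : 0 < n)
  have hq0 : (2 : ℝ) ≤ q := by exact_mod_cast hq
  have hq1 : (0 : ℝ) < q - 1 := by linarith
  have hcast : ((q - 1 : ℕ) : ℝ) = q - 1 := by rw [Nat.cast_sub (by omega), Nat.cast_one]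
  have hlow' : ((q : ℝ) - 1) * (n - k : ℕ) ≤ q * m := by
    rw [← hcast]
    exact_mod_cast hlow
  have hup' : (q : ℝ) * m ≤ (q - 1) * n := by
    rw [← hcast]
    exact_mod_cast hup
  have hexp := etaQ_mul_log_two_le (p := (m : ℝ) / n) hq hε0.le hε hR
    (by rw [div_mul_div_comm, div_le_div_iff₀ (by positivity) hn0]; nlinarith)
    (by rw [div_le_div_iff₀ hn0 (by positivity)]; linarith)
  have hchoose := log_sqrt_mul_choose_ge hm1 hmn
  have hc0 : (0 : ℝ) < n.choose m := by exact_mod_cast Nat.choose_pos hmn.le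
  have hL0 : (0 : ℝ) < L := by exact_mod_cast (by omega : 0 < L)
  have havg' : (q : ℝ) ^ k * (n.choose m * (q - 1) ^ m) ≤ L * q ^ n := by
    rw [← hcast]
    exact_mod_cast havg
  have hlog := Real.log_le_log (by positivity) havg'
  have hlogL := Real.log_lt_log hL0 hLub
  have hs0 : 0 < √(2 * (n : ℝ)) := by positivity
  rw [Real.log_mul (by positivity) (by positivity), Real.log_mul (by positivity) (by positivity),
    Real.log_mul (by positivity) (by positivity)] at hlog
  rw [Real.log_mul (by positivity) (by positivity), one_div, Real.log_inv,
    Real.log_rpow (by norm_num)] at hlogL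
  rw [Real.log_mul (by positivity) (by positivity)] at hchoose
  simp only [Real.log_pow] at hlog
  have hmul := mul_le_mul_of_nonneg_left hexp hn0.le
  have hexpand : (n : ℝ) * (Real.binEntropy (m / n) + m / n * Real.log (q - 1) -
      (n - k : ℕ) / n * Real.log q) = n * Real.binEntropy (m / n) + m * Real.log (q - 1) -
      (n - k) * Real.log q := by
    rw [Nat.cast_sub hkn.le]
    field_simp
  rw [hexpand] at hmul
  linarith

/-- Corollary `L<q-1`: fix `ε ∈ (0, 1/2]`.  If a linear
`[n,k]` code over `GF(q)` of rate `k/n ∈ [ε, 1-ε]` is `(τ,L)`-list decodable,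
where `L < 2^{η_q(ε) n} / √(2n)` and `τ ≥ L(n-k)/(L+1)`, then `C` is MDS. -/
theorem stmt12 {F : Type*} [Field F] [Fintype F] [DecidableEq F]
    {n k L τ : ℕ} (ε : ℝ) (hε0 : 0 < ε) (hε : ε ≤ 1 / 2)
    (C : Submodule F (Fin n → F))
    (hk : Module.finrank F C = k) (hkn : k ≤ n)
    (hR1 : ε ≤ (k : ℝ) / (n : ℝ)) (hR2 : (k : ℝ) / (n : ℝ) ≤ 1 - ε)
    (hL : 1 ≤ L)
    (hLub : (L : ℝ) <
      (1 / Real.sqrt (2 * n)) * (2 : ℝ) ^ (etaQ (Fintype.card F) ε * n))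
    (hτ : (L : ℝ) * ((n - k : ℕ) : ℝ) / ((L : ℝ) + 1) ≤ (τ : ℝ))
    (hdec : ListDecodable (C : Set (Fin n → F)) τ L) :
    IsMDSCode k C := by
  have hn : 0 < n := by
    rcases Nat.eq_zero_or_pos n with rfl | h
    · norm_num at hR1
      linarith
    · exact h
  have hn0 : (0 : ℝ) < n := by exact_mod_cast hn
  have hk1 : 1 ≤ k := by
    rcases Nat.eq_zero_or_pos k with rfl | h
    · norm_num at hR1
      linarith
    · exact h
  have hkn' : k < n := by
    refine lt_of_le_of_ne hkn ?_
    rintro rfl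
    rw [div_self hn0.ne'] at hR2
    linarith
  have hR : ((n - k : ℕ) : ℝ) / n ∈ Set.Icc ε (1 - ε) := by
    rw [Nat.cast_sub hkn, sub_div, div_self hn0.ne']
    constructor <;> linarith
  have hτ' : L * (n - k) ≤ (L + 1) * τ := by
    rw [div_le_iff₀ (by positivity), mul_comm (τ : ℝ)] at hτ
    exact_mod_cast hτ
  rcases lt_or_ge L (Fintype.card F) with hLq | hLq
  · by_contra hmds
    subst hk
    obtain ⟨c, hcC, hc0, hc⟩ := exists_mem_hammingNorm_le_of_not_isMDSCode hk1 hmds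
    rw [Fintype.card_fin] at hc
    exact exists_many_multiples_near hc0 hLq hc hτ' hcC hdec
  · exact (not_listDecodable_of_card_le hε0 hε hk hk1 hkn' hR hLq hLub hτ' hdec).elim
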